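/- arXiv:1709.09751 — 2 statements merged into one kernel-verified Lean document; each statement's English description precedes it below -/
import Mathlib

section
/- Let a : ℕ → ℂ with a(0) = 0, and suppose there exist constants C ≥ 0 and A ≥ 0 such that |a(n)| ≤ C · n^A for all n ≥ 1. Then for every s ∈ ℂ with Re(s) > A + 1, the function t ↦ (∑_{n=1}^∞ a(n) e^{−2πnt}) · t^{s−1} is Lebesgue-integrable on (0, ∞) and ∫₀^∞ (∑_{n=1}^∞ a(n) e^{−2πnt}) t^{s−1} dt = (2π)^{−s} · Γ(s) · ∑_{n=1}^∞ a(n) n^{−s}, where both the defining series and the L-series converge absolutely. -/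
open MeasureTheory

/-- Under the hypotheses of `hasSum_mellin`, the Mellin integral converges absolutely. -/
theorem mellinConvergent_of_summable {ι : Type*} [Countable ι] {a : ι → ℂ} {p : ι → ℝ}
    {F : ℝ → ℂ} {s : ℂ} (hp : ∀ i, a i = 0 ∨ 0 < p i) (hs : 0 < s.re)
    (hF : ∀ t ∈ Set.Ioi (0 : ℝ), HasSum (fun i ↦ a i * Real.exp (-p i * t)) (F t))
    (h_sum : Summable fun i ↦ ‖a i‖ / p i ^ s.re) :
    MellinConvergent F s := by
  by_cases ha : ∀ i, a i = 0
  · refine IntegrableOn.congr_fun (integrableOn_zero) (fun t ht ↦ ?_) measurableSet_Ioi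
    have h := hF t ht
    simp only [ha, zero_mul] at h
    simp [h.unique hasSum_zero]
  push Not at ha
  obtain ⟨j, hj⟩ := ha
  have hnorm (i : ι) (t : ℝ) :
      ‖a i * Real.exp (-p i * t)‖ = ‖a i‖ * Real.exp (-p i * t) := by
    rw [norm_mul, Complex.norm_real, Real.norm_of_nonneg (Real.exp_pos _).le]
  have hsumm (t : ℝ) (ht : t ∈ Set.Ioi (0 : ℝ)) :
      Summable fun i ↦ ‖a i‖ * Real.exp (-p i * t) := by
    simpa only [hnorm] using (hF t ht).summable.norm
  set G : ℝ → ℝ := fun t ↦ ∑' i, ‖a i‖ * Real.exp (-p i * t) with hG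
  have hM := hasSum_mellin (a := fun i ↦ (‖a i‖ : ℂ)) (p := p) (F := fun t ↦ (G t : ℂ))
    (s := (s.re : ℂ)) (fun i ↦ by simpa using hp i) (by simpa using hs)
    (fun t ht ↦ by
      simp_rw [← Complex.ofReal_mul]
      exact Complex.hasSum_ofReal.mpr (hsumm t ht).hasSum)
    (by simpa using h_sum)
  have hpj : 0 < p j := (hp j).resolve_left hj
  have hterm (i : ι) : Complex.Gamma s.re * (‖a i‖ : ℂ) / (p i : ℂ) ^ (s.re : ℂ)
      = ((Real.Gamma s.re * (‖a i‖ / p i ^ s.re) : ℝ) : ℂ) := by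
    rcases hp i with h | h
    · simp [h]
    · rw [Complex.Gamma_ofReal, ← Complex.ofReal_cpow h.le]
      push_cast
      ring
  have hG0 : mellin (fun t ↦ (G t : ℂ)) s.re ≠ 0 := by
    rw [← hM.tsum_eq, tsum_congr hterm, ← Complex.ofReal_tsum, tsum_mul_left]
    refine Complex.ofReal_ne_zero.mpr (mul_pos (Real.Gamma_pos_of_pos hs) ?_).ne'
    refine h_sum.tsum_pos (fun i ↦ ?_) j (by positivity)
    rcases hp i with h | h
    · simp [h]
    · positivity
  have hGint : IntegrableOn (fun t : ℝ ↦ (t : ℂ) ^ ((s.re : ℂ) - 1) • (G t : ℂ))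
      (Set.Ioi 0) := Integrable.of_integral_ne_zero hG0
  refine Integrable.mono hGint ?_ ?_
  · refine AEStronglyMeasurable.smul (f := fun t : ℝ ↦ (t : ℂ) ^ (s - 1)) (g := F) ?_ ?_
    · refine ContinuousOn.aestronglyMeasurable (fun t ht ↦ ?_) measurableSet_Ioi
      exact (Complex.continuousAt_ofReal_cpow_const _ _
        (Or.inr (ne_of_gt ht))).continuousWithinAt
    · refine aestronglyMeasurable_of_tendsto_ae Filter.atTop
        (f := fun (S : Finset ι) (t : ℝ) ↦ ∑ i ∈ S, a i * (Real.exp (-p i * t) : ℂ))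
        (fun S ↦ ?_) ((ae_restrict_iff' measurableSet_Ioi).mpr (ae_of_all _ hF))
      exact Continuous.aestronglyMeasurable (by fun_prop)
  · refine (ae_restrict_iff' measurableSet_Ioi).mpr (ae_of_all _ fun t ht ↦ ?_)
    rw [norm_smul, norm_smul, Complex.norm_cpow_eq_rpow_re_of_pos ht,
      Complex.norm_cpow_eq_rpow_re_of_pos ht]
    simp only [Complex.sub_re, Complex.one_re, Complex.ofReal_re]
    refine mul_le_mul_of_nonneg_left ?_ (Real.rpow_nonneg (le_of_lt ht) _)
    rw [Complex.norm_real, ← (hF t ht).tsum_eq]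
    refine le_trans ?_ (Real.le_norm_self _)
    simpa only [hnorm] using norm_tsum_le_tsum_norm (hF t ht).summable.norm

/-- A sequence bounded by `C * n ^ A` is summable against `n ^ (-σ)` for `σ > A + 1`. -/
theorem summable_norm_div_rpow_of_le {a : ℕ → ℂ} (ha0 : a 0 = 0) {C A σ : ℝ}
    (hbound : ∀ n : ℕ, 1 ≤ n → ‖a n‖ ≤ C * (n : ℝ) ^ A) (hσ : A + 1 < σ) :
    Summable fun n : ℕ ↦ ‖a n‖ / (n : ℝ) ^ σ := by
  refine Summable.of_nonneg_of_le (fun n ↦ by positivity) (fun n ↦ ?_)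
    ((Real.summable_nat_rpow.mpr (show A - σ < -1 by linarith)).mul_left |C|)
  rcases Nat.eq_zero_or_pos n with rfl | hn
  · rw [ha0, norm_zero, zero_div]
    positivity
  · have hn' : (0 : ℝ) < n := Nat.cast_pos.mpr hn
    rw [Real.rpow_sub hn', ← mul_div_assoc]
    have := (hbound n hn).trans
      (mul_le_mul_of_nonneg_right (le_abs_self C) (Real.rpow_nonneg hn'.le A))
    gcongr

/-- Coefficients of polynomial growth are summable against a decaying exponential. -/
theorem summable_mul_exp_of_norm_le {a : ℕ → ℂ} {C A : ℝ}
    (hbound : ∀ n : ℕ, 1 ≤ n → ‖a n‖ ≤ C * (n : ℝ) ^ A) {r : ℝ} (hr : 0 < r) :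
    Summable fun n : ℕ ↦ a n * (Real.exp (-(r * n)) : ℂ) := by
  refine Summable.of_norm_bounded_eventually_nat
    ((Real.summable_pow_mul_exp_neg_nat_mul ⌈A⌉₊ hr).mul_left |C|) ?_
  filter_upwards [Filter.eventually_ge_atTop 1] with n hn
  rw [norm_mul, Complex.norm_real, Real.norm_of_nonneg (Real.exp_pos _).le, ← mul_assoc, neg_mul]
  have hn' : (1 : ℝ) ≤ n := Nat.one_le_cast.mpr hn
  refine mul_le_mul_of_nonneg_right ?_ (Real.exp_pos _).le
  calc ‖a n‖ ≤ C * (n : ℝ) ^ A := hbound n hn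
    _ ≤ |C| * (n : ℝ) ^ A := by gcongr; exact le_abs_self C
    _ ≤ |C| * (n : ℝ) ^ ⌈A⌉₊ := by
      rw [← Real.rpow_natCast]
      gcongr
      exact Nat.le_ceil A

/-- Mellin transform of a q-expansion with polynomially bounded
coefficients: for `Re s > A + 1`, the function
`t ↦ (∑_{n≥1} a(n) e^{-2πnt}) t^{s-1}` is integrable on `(0,∞)` and its integral
equals `(2π)^{-s} Γ(s) ∑ a(n) n^{-s}`, with absolute convergence of both series. -/
theorem stmt_1 (a : ℕ → ℂ) (ha0 : a 0 = 0) (C A : ℝ) (hC : 0 ≤ C) (hA : 0 ≤ A)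
    (hbound : ∀ n : ℕ, 1 ≤ n → ‖a n‖ ≤ C * (n : ℝ) ^ A)
    (s : ℂ) (hs : A + 1 < s.re) :
    (∀ t : ℝ, 0 < t →
        Summable (fun n : ℕ => a n * Complex.exp (-(2 * Real.pi * n * t : ℝ)))) ∧
    Summable (fun n : ℕ => a n * (n : ℂ) ^ (-s)) ∧
    IntegrableOn
      (fun t : ℝ =>
        (∑' n : ℕ, a n * Complex.exp (-(2 * Real.pi * n * t : ℝ))) * (t : ℂ) ^ (s - 1))
      (Set.Ioi (0 : ℝ)) ∧
    ∫ t in Set.Ioi (0 : ℝ),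
        (∑' n : ℕ, a n * Complex.exp (-(2 * Real.pi * n * t : ℝ))) * (t : ℂ) ^ (s - 1)
      = ((2 * Real.pi : ℝ) : ℂ) ^ (-s) * Complex.Gamma s *
          ∑' n : ℕ, a n * (n : ℂ) ^ (-s) := by
  have hs0 : 0 < s.re := by linarith
  have hexp (n : ℕ) (t : ℝ) : Complex.exp (-(2 * Real.pi * n * t : ℝ))
      = (Real.exp (-(2 * Real.pi * n) * t) : ℂ) := by
    rw [neg_mul, Complex.ofReal_exp, Complex.ofReal_neg]
  have hsum (t : ℝ) (ht : 0 < t) :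
      Summable (fun n : ℕ => a n * Complex.exp (-(2 * Real.pi * n * t : ℝ))) := by
    have h := summable_mul_exp_of_norm_le hbound (r := 2 * Real.pi * t) (by positivity)
    refine h.congr fun n ↦ ?_
    rw [hexp]
    ring_nf
  have hpos (n : ℕ) : a n = 0 ∨ 0 < 2 * Real.pi * n := by
    rcases Nat.eq_zero_or_pos n with rfl | hn
    · exact Or.inl ha0
    · exact Or.inr (by positivity)
  have hdiv := summable_norm_div_rpow_of_le ha0 hbound hs
  have hdiv' : Summable fun n : ℕ ↦ ‖a n‖ / (2 * Real.pi * n) ^ s.re := by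
    refine (hdiv.mul_left ((2 * Real.pi) ^ s.re)⁻¹).congr fun n ↦ ?_
    rw [Real.mul_rpow (x := 2 * Real.pi) (by positivity) (by positivity)]
    ring
  have hF : ∀ t ∈ Set.Ioi (0 : ℝ), HasSum
      (fun n : ℕ ↦ a n * (Real.exp (-(2 * Real.pi * n) * t) : ℂ))
      (∑' n : ℕ, a n * Complex.exp (-(2 * Real.pi * n * t : ℝ))) := fun t ht ↦ by
    simpa only [hexp] using (hsum t ht).hasSum
  have hconv := mellinConvergent_of_summable hpos hs0 hF hdiv'
  have hM := hasSum_mellin hpos hs0 hF hdiv'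
  refine ⟨hsum, ?_, ?_, ?_⟩
  · refine Summable.of_norm (hdiv.congr fun n ↦ ?_)
    rcases Nat.eq_zero_or_pos n with rfl | hn
    · simp [ha0]
    · rw [norm_mul, Complex.norm_natCast_cpow_of_pos hn, Complex.neg_re,
        Real.rpow_neg (Nat.cast_nonneg n), div_eq_mul_inv]
  · simpa only [MellinConvergent, smul_eq_mul, mul_comm] using hconv
  · rw [← tsum_mul_left]
    simp_rw [mul_comm _ (_ ^ (s - 1))]
    refine hM.tsum_eq.symm.trans (tsum_congr fun n ↦ ?_)
    rw [Complex.ofReal_mul, Complex.mul_cpow_ofReal_nonneg (by positivity) (by positivity),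
      Complex.cpow_neg, Complex.cpow_neg, Complex.ofReal_natCast]
    ring
end

section
/- Consider the eight linear forms on ℚ⁴ defining arrangement No. 1: L₁ = x, L₂ = y, L₃ = z, L₄ = t, L₅ = x + y, L₆ = y + z, L₇ = z + t, L₈ = t + x. At the point q = (1, −1, 1, −1) exactly the four forms L₅, L₆, L₇, L₈ vanish, and any three of these four forms are linearly independent. Moreover, q is, up to nonzero scalar multiple, the unique nonzero point of ℚ⁴ at which exactly four of the eight forms vanish such that every three of the vanishing forms are linearly independent. -/
/-- The coefficient matrix of the eight linear forms
`x, y, z, t, x+y, y+z, z+t, t+x` of arrangement No. 1: the `i`-th row is the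
coefficient vector of the `i`-th form. -/
def arrOneM : Matrix (Fin 8) (Fin 4) ℚ :=
  !![1, 0, 0, 0;
     0, 1, 0, 0;
     0, 0, 1, 0;
     0, 0, 0, 1;
     1, 1, 0, 0;
     0, 1, 1, 0;
     0, 0, 1, 1;
     1, 0, 0, 1]

theorem linearIndependent_arrOneM_of_subset (S : Finset (Fin 8))
    (hS : S ⊆ ({4, 5, 6, 7} : Finset (Fin 8))) (hcard : S.card = 3) :
    LinearIndependent ℚ (fun i : ↥S => arrOneM i) := by
  have hmem : S = {4, 5, 6} ∨ S = {4, 5, 7} ∨ S = {4, 6, 7} ∨ S = {5, 6, 7} := by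
    have h : S ∈ Finset.powersetCard 3 ({4, 5, 6, 7} : Finset (Fin 8)) :=
      Finset.mem_powersetCard.2 ⟨hS, hcard⟩
    have hall : ∀ S ∈ Finset.powersetCard 3 ({4, 5, 6, 7} : Finset (Fin 8)),
        S = {4, 5, 6} ∨ S = {4, 5, 7} ∨ S = {4, 6, 7} ∨ S = {5, 6, 7} := by decide +kernel
    exact hall S h
  change LinearIndepOn ℚ (fun i => arrOneM i) (S : Set (Fin 8))
  rw [linearIndepOn_finset_iff]
  intro f hf
  have h0 := congrFun hf 0
  have h1 := congrFun hf 1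
  have h2 := congrFun hf 2
  have h3 := congrFun hf 3
  rcases hmem with rfl | rfl | rfl | rfl <;>
    simp [arrOneM] at h0 h1 h2 h3 ⊢ <;>
    refine ⟨?_, ?_, ?_⟩ <;> linarith

theorem not_linearIndependent_of_eq_add {ι R V : Type*} [DecidableEq ι] [Ring R] [Nontrivial R]
    [AddCommGroup V] [Module R V] {v : ι → V} {i j k : ι} (hij : i ≠ j) (hik : i ≠ k)
    (hjk : j ≠ k) (h : v k = v i + v j) :
    ¬ LinearIndependent R (fun l : ↥({i, j, k} : Finset ι) => v l) := by
  intro hli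
  change LinearIndepOn R v (({i, j, k} : Finset ι) : Set ι) at hli
  rw [linearIndepOn_finset_iff] at hli
  have := hli (fun l => if l = k then -1 else 1)
    (by simp [Finset.sum_insert, hij, hik, hjk, h]) i (by simp)
  simp [hik] at this

theorem arrOneM_mulVec_eq_zero_iff (q : Fin 4 → ℚ) (T : Finset (Fin 8))
    (hT : ∀ i : Fin 8, arrOneM.mulVec q i = 0 ↔ i ∈ T) :
    (q 0 = 0 ↔ 0 ∈ T) ∧ (q 1 = 0 ↔ 1 ∈ T) ∧ (q 2 = 0 ↔ 2 ∈ T) ∧ (q 3 = 0 ↔ 3 ∈ T) ∧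
    (q 0 + q 1 = 0 ↔ 4 ∈ T) ∧ (q 1 + q 2 = 0 ↔ 5 ∈ T) ∧
    (q 2 + q 3 = 0 ↔ 6 ∈ T) ∧ (q 0 + q 3 = 0 ↔ 7 ∈ T) := by
  simp only [← hT]
  simp [arrOneM, Matrix.mulVec, dotProduct, Fin.sum_univ_four]

theorem ne_zero_of_four_vanish {a b c d : ℚ}
    (hab : ¬ (a = 0 ∧ b = 0 ∧ a + b = 0)) (hda : ¬ (a = 0 ∧ d = 0 ∧ a + d = 0))
    (h : 4 = (if a = 0 then 1 else 0) + (if b = 0 then 1 else 0) + (if c = 0 then 1 else 0) +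
      (if d = 0 then 1 else 0) + (if a + b = 0 then 1 else 0) + (if b + c = 0 then 1 else 0) +
      (if c + d = 0 then 1 else 0) + (if a + d = 0 then 1 else 0)) : a ≠ 0 := by
  rintro rfl
  have hb : b ≠ 0 := by simpa using hab
  have hd : d ≠ 0 := by simpa using hda
  by_cases hc : c = 0
  · simp [hb, hc, hd] at h
  · simp only [zero_add, hb, hc, hd, if_true, if_false] at h
    split_ifs at h <;> lia

/-- At `q = (1,−1,1,−1)` exactly the forms `L₅, L₆, L₇, L₈`
(indices `4,5,6,7`) of arrangement No. 1 vanish, any three of these four forms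
are linearly independent, and `q` is, up to nonzero scalar, the unique nonzero
point of `ℚ⁴` at which exactly four of the eight forms vanish with every three
of the vanishing forms linearly independent. -/
theorem stmt_7 :
    (∀ i : Fin 8, arrOneM.mulVec ![1, -1, 1, -1] i = 0 ↔
        i ∈ ({4, 5, 6, 7} : Finset (Fin 8))) ∧
    (∀ S : Finset (Fin 8), S ⊆ ({4, 5, 6, 7} : Finset (Fin 8)) → S.card = 3 →
        LinearIndependent ℚ (fun i : ↥S => arrOneM i)) ∧
    (∀ q' : Fin 4 → ℚ, q' ≠ 0 →
      (∃ T : Finset (Fin 8), T.card = 4 ∧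
          (∀ i : Fin 8, arrOneM.mulVec q' i = 0 ↔ i ∈ T) ∧
          ∀ S : Finset (Fin 8), S ⊆ T → S.card = 3 →
            LinearIndependent ℚ (fun i : ↥S => arrOneM i)) →
      ∃ c : ℚ, c ≠ 0 ∧ q' = c • ![1, -1, 1, -1]) := by
  refine ⟨?_, linearIndependent_arrOneM_of_subset, ?_⟩
  · intro i
    fin_cases i <;> simp [arrOneM, Matrix.mulVec, dotProduct, Fin.sum_univ_four]
  · rintro q - ⟨T, hcard, hT, hli⟩
    obtain ⟨h0, h1, h2, h3, h4, h5, h6, h7⟩ := arrOneM_mulVec_eq_zero_iff q T hT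
    have hdep : ∀ i j k : Fin 8, i ≠ j → i ≠ k → j ≠ k →
        arrOneM k = arrOneM i + arrOneM j → ¬ (i ∈ T ∧ j ∈ T ∧ k ∈ T) := by
      rintro i j k hij hik hjk h ⟨hi, hj, hk⟩
      refine not_linearIndependent_of_eq_add (R := ℚ) hij hik hjk h (hli {i, j, k} ?_ ?_)
      · simp [Finset.insert_subset_iff, hi, hj, hk]
      · exact Finset.card_eq_three.2 ⟨i, j, k, hij, hik, hjk, rfl⟩
    have d01 := hdep 0 1 4 (by decide) (by decide) (by decide)
      (by ext l; fin_cases l <;> simp [arrOneM])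
    have d12 := hdep 1 2 5 (by decide) (by decide) (by decide)
      (by ext l; fin_cases l <;> simp [arrOneM])
    have d23 := hdep 2 3 6 (by decide) (by decide) (by decide)
      (by ext l; fin_cases l <;> simp [arrOneM])
    have d03 := hdep 0 3 7 (by decide) (by decide) (by decide)
      (by ext l; fin_cases l <;> simp [arrOneM])
    have hsum : T.card = ∑ i : Fin 8, if i ∈ T then 1 else 0 := by simp
    rw [hcard, Fin.sum_univ_eight] at hsum
    simp only [← h0, ← h1, ← h2, ← h3, ← h4, ← h5, ← h6, ← h7] at hsum d01 d12 d23 d03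
    clear hdep hli hT hcard h0 h1 h2 h3 h4 h5 h6 h7
    have hne : q 0 ≠ 0 ∧ q 1 ≠ 0 ∧ q 2 ≠ 0 ∧ q 3 ≠ 0 := by
      refine ⟨ne_zero_of_four_vanish d01 d03 hsum,
        ne_zero_of_four_vanish (b := q 2) (c := q 3) (d := q 0) d12 ?_ ?_,
        ne_zero_of_four_vanish (b := q 3) (c := q 0) (d := q 1) d23 ?_ ?_,
        ne_zero_of_four_vanish (b := q 0) (c := q 1) (d := q 2) ?_ ?_ ?_⟩
      · rw [add_comm (q 1)]; tauto
      · rw [add_comm (q 3), add_comm (q 1) (q 0)]; linarith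
      · rw [add_comm (q 2)]; tauto
      · rw [add_comm (q 3), add_comm (q 2) (q 1)]; linarith
      · rw [add_comm (q 3)]; tauto
      · rw [add_comm (q 3)]; tauto
      · rw [add_comm (q 3) (q 0), add_comm (q 3) (q 2)]; linarith
    obtain ⟨n0, n1, n2, n3⟩ := hne
    have hzero : q 0 + q 1 = 0 ∧ q 1 + q 2 = 0 ∧ q 2 + q 3 = 0 := by
      simp only [n0, n1, n2, n3, if_false] at hsum
      split_ifs at hsum <;> first | exact ⟨‹_›, ‹_›, ‹_›⟩ | lia
    obtain ⟨s0, s1, s2⟩ := hzero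
    refine ⟨q 0, n0, ?_⟩
    ext l
    fin_cases l <;> simp <;> linarith
end
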